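/- arXiv:1901.01587 — 2 statements merged into one kernel-verified Lean document; each statement's English description precedes it below -/
import Mathlib

section
/- Let V be a real symmetric log-concave random variable. Then for any t > 0 and λ ∈ (0,1], E[|V|·1_{{|V| ≥ t}}] ≤ (4/λ)·P(|V| ≥ t)^{1−λ}·E[|V|·1_{{|V| ≥ λt}}]. -/
open MeasureTheory Finset Pointwise

noncomputable def maxKSum {n : ℕ} (k : ℕ) (x : Fin n → ℝ) : ℝ :=
  sSup {y | ∃ I : Finset (Fin n), I.card = k ∧ y = ∑ i ∈ I, |x i|}

noncomputable def kthMax {n : ℕ} (k : ℕ) (x : Fin n → ℝ) : ℝ :=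
  sSup {t : ℝ | k ≤ (Finset.univ.filter (fun i => t ≤ |x i|)).card}

noncomputable def tk {Ω : Type*} [MeasurableSpace Ω] (μ : Measure Ω) {n : ℕ}
    (X : Fin n → Ω → ℝ) (k : ℝ) : ℝ :=
  sInf {t : ℝ | 0 < t ∧ ∑ i, ∫ ω in {ω | t ≤ |X i ω|}, |X i ω| ∂μ ≤ k * t}

noncomputable def tstar {Ω : Type*} [MeasurableSpace Ω] (μ : Measure Ω) {n : ℕ}
    (X : Fin n → Ω → ℝ) (p : ℝ) : ℝ :=
  sInf {t : ℝ | 0 < t ∧ ∑ i, (μ {ω | t ≤ |X i ω|}).toReal ≤ p}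

def IsLogConcave {E : Type*} [AddCommGroup E] [Module ℝ E] [TopologicalSpace E]
    [MeasurableSpace E] (ν : Measure E) : Prop :=
  ∀ (K L : Set E) (l : ℝ), IsCompact K → IsCompact L → K.Nonempty → L.Nonempty →
    l ∈ Set.Icc (0 : ℝ) 1 → ν K ^ l * ν L ^ (1 - l) ≤ ν (l • K + (1 - l) • L)

noncomputable def med {Ω : Type*} [MeasurableSpace Ω] (μ : Measure Ω) (f : Ω → ℝ) : ℝ :=
  sInf {t : ℝ | (1 : ℝ) / 2 ≤ (μ {ω | f ω ≤ t}).toReal}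

noncomputable def kthMaxOn {n : ℕ} (J : Finset (Fin n)) (k : ℕ) (x : Fin n → ℝ) : ℝ :=
  sSup {t : ℝ | k ≤ (J.filter (fun i => t ≤ |x i|)).card}


theorem aux_half (ν : Measure ℝ) [IsProbabilityMeasure ν] (hlc : IsLogConcave ν)
    (t : ℝ) (ht : 0 < t) (l : ℝ) (hl0 : 0 < l) (hl1 : l ≤ 1) :
    ν (Set.Ici t) ^ l * ν (Set.Ici 0) ^ (1 - l) ≤ ν (Set.Ici (l * t)) := by
  have lim : ∀ a : ℝ, Filter.Tendsto (fun n : ℕ => ν (Set.Icc a (t + n))) Filter.atTop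
      (nhds (ν (Set.Ici a))) := by
    intro a
    have h1 : Monotone (fun n : ℕ => Set.Icc a (t + n)) := by
      intro m n hmn
      apply Set.Icc_subset_Icc_right
      have : (m : ℝ) ≤ n := by exact_mod_cast hmn
      linarith
    have h2 : (⋃ n : ℕ, Set.Icc a (t + n)) = Set.Ici a := by
      ext x
      simp only [Set.mem_iUnion, Set.mem_Icc, Set.mem_Ici]
      constructor
      · rintro ⟨n, h, _⟩; exact h
      · intro h
        obtain ⟨n, hn⟩ := exists_nat_ge (x - t)
        exact ⟨n, h, by linarith⟩
    have h3 := tendsto_measure_iUnion_atTop (μ := ν) h1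
    rw [h2] at h3
    exact h3
  have h1 : Filter.Tendsto (fun n : ℕ => ν (Set.Icc t (t + n)) ^ l * ν (Set.Icc 0 (t + n)) ^ (1 - l))
      Filter.atTop (nhds (ν (Set.Ici t) ^ l * ν (Set.Ici 0) ^ (1 - l))) := by
    refine ENNReal.Tendsto.mul ((ENNReal.continuous_rpow_const.tendsto _).comp (lim t)) (Or.inr ?_)
      ((ENNReal.continuous_rpow_const.tendsto _).comp (lim 0)) (Or.inr ?_)
    · exact ENNReal.rpow_ne_top_of_nonneg (by linarith) (measure_ne_top _ _)
    · exact ENNReal.rpow_ne_top_of_nonneg (by linarith) (measure_ne_top _ _)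
  refine le_of_tendsto h1 (Filter.Eventually.of_forall fun n => ?_)
  have hn : (0 : ℝ) ≤ n := Nat.cast_nonneg n
  refine (hlc _ _ l isCompact_Icc isCompact_Icc ⟨t, ?_⟩ ⟨t, ?_⟩ ⟨hl0.le, hl1⟩).trans
    (measure_mono ?_)
  · constructor <;> linarith
  · constructor <;> linarith
  · rintro x ⟨y, ⟨k, hk, rfl⟩, z, ⟨m, hm, rfl⟩, rfl⟩
    simp only [smul_eq_mul, Set.mem_Ici]
    have := mul_le_mul_of_nonneg_left hk.1 hl0.le
    have := mul_nonneg (sub_nonneg.2 hl1) hm.1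
    linarith

theorem aux_tail {Ω : Type*} [MeasurableSpace Ω] (μ : Measure Ω) [IsProbabilityMeasure μ]
    (V : Ω → ℝ) (hmeas : Measurable V)
    (hsym : μ.map V = μ.map (fun ω => -V ω)) (hlc : IsLogConcave (μ.map V))
    (t : ℝ) (ht : 0 < t) (l : ℝ) (hl0 : 0 < l) (hl1 : l ≤ 1) :
    μ {ω | t ≤ |V ω|} ^ l ≤ μ {ω | l * t ≤ |V ω|} := by
  have : IsProbabilityMeasure (μ.map V) := Measure.isProbabilityMeasure_map hmeas.aemeasurable
  have hmn : Measurable (fun ω => -V ω) := hmeas.neg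
  have key := aux_half (μ.map V) hlc t ht l hl0 hl1
  have hneg : ∀ s : ℝ, μ {ω | s ≤ -V ω} = μ.map V (Set.Ici s) := by
    intro s
    rw [hsym, Measure.map_apply hmn measurableSet_Ici]
    rfl
  have hpos : ∀ s : ℝ, μ {ω | s ≤ V ω} = μ.map V (Set.Ici s) := by
    intro s
    rw [Measure.map_apply hmeas measurableSet_Ici]
    rfl
  have hun : ∀ s : ℝ, {ω | s ≤ |V ω|} = {ω | s ≤ V ω} ∪ {ω | s ≤ -V ω} := by
    intro s; ext ω; simp [le_abs]
  have hG : ∀ s : ℝ, 0 < s → μ {ω | s ≤ |V ω|} = 2 * μ.map V (Set.Ici s) := by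
    intro s hs
    rw [hun, measure_union _ (measurableSet_le measurable_const hmn), hneg, hpos, two_mul]
    rw [Set.disjoint_left]
    intro ω h1 h2
    simp only [Set.mem_ofPred_eq] at h1 h2
    linarith
  have h0 : 1 ≤ 2 * μ.map V (Set.Ici 0) := by
    rw [two_mul]
    nth_rw 1 [← hneg]
    rw [← hpos]
    refine le_trans ?_ (measure_union_le _ _)
    rw [Set.union_comm, ← hun]
    simp
  rw [hG t ht, hG _ (mul_pos hl0 ht)]
  calc (2 * μ.map V (Set.Ici t)) ^ l
      ≤ (2 * μ.map V (Set.Ici t)) ^ l * (2 * μ.map V (Set.Ici 0)) ^ (1 - l) := by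
        apply le_mul_of_one_le_right (zero_le)
        simpa using ENNReal.rpow_le_rpow h0 (sub_nonneg.2 hl1)
    _ = (2 ^ l * 2 ^ (1 - l)) * (μ.map V (Set.Ici t) ^ l * μ.map V (Set.Ici 0) ^ (1 - l)) := by
        rw [ENNReal.mul_rpow_of_nonneg _ _ hl0.le, ENNReal.mul_rpow_of_nonneg _ _ (by linarith)]
        ring
    _ = 2 * (μ.map V (Set.Ici t) ^ l * μ.map V (Set.Ici 0) ^ (1 - l)) := by
        rw [← ENNReal.rpow_add _ _ (by simp) (by simp)]
        simp
    _ ≤ _ := by gcongr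

theorem aux_lint {Ω : Type*} [MeasurableSpace Ω] (μ : Measure Ω) [IsProbabilityMeasure μ]
    (V : Ω → ℝ) (hmeas : Measurable V)
    (hsym : μ.map V = μ.map (fun ω => -V ω)) (hlc : IsLogConcave (μ.map V))
    (t : ℝ) (ht : 0 < t) (l : ℝ) (hl0 : 0 < l) (hl1 : l ≤ 1) :
    ∫⁻ ω in {ω | t ≤ |V ω|}, ENNReal.ofReal (l * |V ω|) ∂μ ≤
      μ {ω | t ≤ |V ω|} ^ (1 - l) * ∫⁻ ω in {ω | l * t ≤ |V ω|}, ENNReal.ofReal |V ω| ∂μ := by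
  have hm : Measurable (fun ω => |V ω|) := hmeas.abs
  have hS : ∀ s : ℝ, MeasurableSet {ω | s ≤ |V ω|} := fun s => measurableSet_le measurable_const hm
  have hbase : ∀ s : ℝ, t ≤ s → μ {ω | s ≤ |V ω|} ≤
      μ {ω | t ≤ |V ω|} ^ (1 - l) * μ {ω | l * s ≤ |V ω|} := by
    intro s hs
    calc μ {ω | s ≤ |V ω|} = μ {ω | s ≤ |V ω|} ^ (1 - l) * μ {ω | s ≤ |V ω|} ^ l := by
          rw [← ENNReal.rpow_add_of_nonneg _ _ (by linarith) hl0.le]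
          simp
      _ ≤ _ := by
          refine mul_le_mul' (ENNReal.rpow_le_rpow (measure_mono ?_) (by linarith))
            (aux_tail μ V hmeas hsym hlc s (by linarith) l hl0 hl1)
          intro ω hω
          exact hs.trans hω
  rw [lintegral_eq_lintegral_meas_le _ (Filter.Eventually.of_forall fun ω => by positivity)
      (hm.const_mul l).aemeasurable,
    lintegral_eq_lintegral_meas_le _ (Filter.Eventually.of_forall fun ω => by positivity)
      hm.aemeasurable, ← lintegral_const_mul']
  · refine setLIntegral_mono' measurableSet_Ioi fun u hu => ?_
    rw [Measure.restrict_apply (measurableSet_le measurable_const (hm.const_mul l)),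
      Measure.restrict_apply (hS u)]
    rcases le_total u (l * t) with h | h
    · refine (measure_mono Set.inter_subset_right).trans ((hbase t le_rfl).trans ?_)
      gcongr
      intro ω hω
      exact ⟨h.trans hω, hω⟩
    · have h' : t ≤ u / l := by rw [le_div_iff₀ hl0]; linarith
      refine le_trans (measure_mono ?_) ((hbase (u / l) h').trans ?_)
      · rintro ω ⟨hω, _⟩
        simp only [Set.mem_ofPred_eq] at hω ⊢
        rw [div_le_iff₀ hl0]; linarith
      · gcongr
        intro ω hω
        simp only [Set.mem_ofPred_eq, mul_div_cancel₀ _ hl0.ne'] at hω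
        exact ⟨hω, h.trans hω⟩
  · exact ENNReal.rpow_ne_top_of_nonneg (by linarith) (measure_ne_top _ _)

theorem stmt_6 {Ω : Type*} [MeasurableSpace Ω] (μ : Measure Ω) [IsProbabilityMeasure μ]
    (V : Ω → ℝ) (hmeas : Measurable V)
    (hsym : μ.map V = μ.map (fun ω => -V ω)) (hlc : IsLogConcave (μ.map V)) :
    ∀ t : ℝ, 0 < t → ∀ l : ℝ, l ∈ Set.Ioc (0 : ℝ) 1 →
      ∫ ω in {ω | t ≤ |V ω|}, |V ω| ∂μ ≤
        (4 / l) * (μ {ω | t ≤ |V ω|}).toReal ^ (1 - l) *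
          ∫ ω in {ω | l * t ≤ |V ω|}, |V ω| ∂μ := by
  rintro t ht l ⟨hl0, hl1⟩
  have hm : Measurable (fun ω => |V ω|) := hmeas.abs
  have hS : ∀ s : ℝ, MeasurableSet {ω | s ≤ |V ω|} := fun s => measurableSet_le measurable_const hm
  have hR : 0 ≤ ∫ ω in {ω | l * t ≤ |V ω|}, |V ω| ∂μ := integral_nonneg fun ω => abs_nonneg _
  by_cases hi : IntegrableOn (fun ω => |V ω|) {ω | t ≤ |V ω|} μ
  swap
  · rw [integral_undef hi]
    positivity
  have hi' : Integrable (fun ω => |V ω|) μ := by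
    refine ((integrable_const t).add (hi.integrable_indicator (hS t))).mono' 
      hm.aestronglyMeasurable (Filter.Eventually.of_forall fun ω => ?_)
    by_cases h : t ≤ |V ω|
    · simp [h, ht.le]
    · simp [h]; linarith
  have key := aux_lint μ V hmeas hsym hlc t ht l hl0 hl1
  have hfin : ∫⁻ ω in {ω | l * t ≤ |V ω|}, ENNReal.ofReal |V ω| ∂μ ≠ ⊤ := by
    have := hi'.integrableOn (s := {ω | l * t ≤ |V ω|})
    exact (hasFiniteIntegral_iff_ofReal (Filter.Eventually.of_forall fun ω => abs_nonneg _)).1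
      this.2 |>.ne
  have key2 := ENNReal.toReal_mono (ENNReal.mul_ne_top
    (ENNReal.rpow_ne_top_of_nonneg (by linarith) (measure_ne_top _ _)) hfin) key
  rw [ENNReal.toReal_mul, ← ENNReal.toReal_rpow,
    ← integral_eq_lintegral_of_nonneg_ae (Filter.Eventually.of_forall fun ω => by positivity)
      (hm.const_mul l).aestronglyMeasurable,
    ← integral_eq_lintegral_of_nonneg_ae (Filter.Eventually.of_forall fun ω => by positivity)
      hm.aestronglyMeasurable, integral_const_mul] at key2
  set B := (μ {ω | t ≤ |V ω|}).toReal ^ (1 - l) * ∫ ω in {ω | l * t ≤ |V ω|}, |V ω| ∂μ with hB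
  have hB0 : 0 ≤ B := by positivity
  rw [mul_assoc, ← hB, div_mul_eq_mul_div, le_div_iff₀ hl0]
  linarith
end

section
/- Let X be a symmetric log-concave random vector in R^n and 1 ≤ k ≤ n. Define t(k,X) := inf{t>0 : (1/t)·Σ_i E[|X_i|·1_{{|X_i|≥t}}] ≤ k}, t*(k,X) := inf{t>0 : Σ_i P(|X_i| ≥ t) ≤ k}, and M_k := (1/k)·max_{|I|=k} Σ_{i∈I} E|X_i|. Then (1/3)·(t*(k,X) + M_k) ≤ t(k,X) ≤ 4·(t*(k,X) + M_k). -/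
open MeasureTheory Finset Pointwise

/-- Half-space log-concavity. -/
lemma half_lc {n : ℕ} (ν : Measure (Fin n → ℝ)) [IsProbabilityMeasure ν] (hlc : IsLogConcave ν)
    (i : Fin n) (s t l : ℝ) (hl0 : 0 < l) (hl1 : l < 1) :
    ν {x | s ≤ x i} ^ l * ν {x | t ≤ x i} ^ (1 - l) ≤ ν {x | l * s + (1 - l) * t ≤ x i} := by
  have hcl : ∀ s : ℝ, IsClosed {x : Fin n → ℝ | s ≤ x i} := fun s =>
    isClosed_le continuous_const (continuous_apply i)
  have key : ∀ s : ℝ, Filter.Tendsto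
      (fun m : ℕ => ν ({x : Fin n → ℝ | s ≤ x i} ∩ Metric.closedBall 0 (m : ℝ)))
      Filter.atTop (nhds (ν {x | s ≤ x i})) := by
    intro s
    have h1 : {x : Fin n → ℝ | s ≤ x i}
        = ⋃ m : ℕ, ({x : Fin n → ℝ | s ≤ x i} ∩ Metric.closedBall 0 (m : ℝ)) := by
      rw [← Set.inter_iUnion, Metric.iUnion_closedBall_nat, Set.inter_univ]
    have h2 := tendsto_measure_iUnion_atTop (μ := ν)
      (s := fun m : ℕ => ({x : Fin n → ℝ | s ≤ x i} ∩ Metric.closedBall 0 (m : ℝ))) (by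
        intro a b hab
        exact Set.inter_subset_inter_right _ (Metric.closedBall_subset_closedBall (by exact_mod_cast hab)))
    rw [← h1] at h2
    exact h2
  have hl : 0 < 1 - l := by linarith
  have T1 := ((ENNReal.continuous_rpow_const (y := l)).tendsto _).comp (key s)
  have T2 := ((ENNReal.continuous_rpow_const (y := 1 - l)).tendsto _).comp (key t)
  have T := ENNReal.Tendsto.mul T1
    (Or.inr (ENNReal.rpow_ne_top_of_nonneg hl.le (measure_ne_top _ _))) T2
    (Or.inr (ENNReal.rpow_ne_top_of_nonneg hl0.le (measure_ne_top _ _)))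
  refine le_of_tendsto T (Filter.Eventually.of_forall fun m => ?_)
  simp only [Function.comp]
  rcases Set.eq_empty_or_nonempty ({x : Fin n → ℝ | s ≤ x i} ∩ Metric.closedBall 0 (m : ℝ))
    with h | h
  · rw [h]; simp [hl0]
  rcases Set.eq_empty_or_nonempty ({x : Fin n → ℝ | t ≤ x i} ∩ Metric.closedBall 0 (m : ℝ))
    with h' | h'
  · rw [h']; simp [hl]
  refine (hlc _ _ l ((isCompact_closedBall _ _).inter_left (hcl s))
    ((isCompact_closedBall _ _).inter_left (hcl t)) h h' ⟨hl0.le, hl1.le⟩).trans (measure_mono ?_)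
  rintro _ ⟨_, ⟨x, hx, rfl⟩, _, ⟨y, hy, rfl⟩, rfl⟩
  have hx1 : s ≤ x i := hx.1
  have hy1 : t ≤ y i := hy.1
  have := mul_le_mul_of_nonneg_left hx1 hl0.le
  have := mul_le_mul_of_nonneg_left hy1 hl.le
  simp only [Set.mem_ofPred_eq, Pi.add_apply, Pi.smul_apply, smul_eq_mul]
  linarith

lemma tail_mul {n : ℕ} (ν : Measure (Fin n → ℝ)) [IsProbabilityMeasure ν] (hlc : IsLogConcave ν)
    (hs : ν.map (fun x => -x) = ν) (i : Fin n) (a b : ℝ) (ha : 0 < a) (hb : 0 < b) :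
    ν {x | a + b ≤ |x i|} ≤ ν {x | a ≤ |x i|} * ν {x | b ≤ |x i|} := by
  have hm : ∀ s : ℝ, MeasurableSet {x : Fin n → ℝ | s ≤ x i} := fun s =>
    measurableSet_le measurable_const (measurable_pi_apply i)
  have hneg : ∀ s : ℝ, ν {x | s ≤ - x i} = ν {x | s ≤ x i} := by
    intro s
    conv_rhs => rw [← hs]
    rw [Measure.map_apply measurable_neg (hm s)]
    rfl
  have h2 : ∀ s : ℝ, 0 < s → ν {x | s ≤ |x i|} = 2 * ν {x | s ≤ x i} := by
    intro s hs0
    have : {x : Fin n → ℝ | s ≤ |x i|} = {x | s ≤ x i} ∪ {x | s ≤ - x i} := by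
      ext x; simp [le_abs]
    rw [this, measure_union' _ (hm s), hneg, two_mul]
    rw [Set.disjoint_left]
    intro x hx hx'
    simp only [Set.mem_ofPred_eq] at hx hx'
    linarith
  have h0 : 1 ≤ 2 * ν {x | (0 : ℝ) ≤ x i} := by
    have : (Set.univ : Set (Fin n → ℝ)) = {x | 0 ≤ x i} ∪ {x | 0 ≤ - x i} := by
      ext x; simp [le_total]
    have h := measure_union_le (μ := ν) {x | (0 : ℝ) ≤ x i} {x | 0 ≤ - x i}
    rw [← this, measure_univ, hneg, ← two_mul] at h
    exact h
  have main : ∀ a b : ℝ, 0 < a → 0 < b →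
      (ν {x | a + b ≤ |x i|}) ^ (a / (a + b)) ≤ ν {x | a ≤ |x i|} := by
    intro a b ha hb
    have hab : 0 < a + b := by linarith
    have hl0 : 0 < a / (a + b) := by positivity
    have hl1 : a / (a + b) < 1 := by rw [div_lt_one hab]; linarith
    have h := half_lc ν hlc i (a + b) 0 (a / (a + b)) hl0 hl1
    have e : a / (a + b) * (a + b) + (1 - a / (a + b)) * 0 = a := by field_simp; ring
    rw [e] at h
    rw [h2 _ hab, h2 _ ha]
    set l := a / (a + b)
    have hl : 0 ≤ 1 - l := by linarith
    calc (2 * ν {x | a + b ≤ x i}) ^ l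
        ≤ (2 * ν {x | a + b ≤ x i}) ^ l * (2 * ν {x | (0 : ℝ) ≤ x i}) ^ (1 - l) := by
          refine le_mul_of_one_le_right' ?_
          exact ENNReal.one_le_rpow h0 (by linarith)
      _ = (2 ^ l * 2 ^ (1 - l)) * (ν {x | a + b ≤ x i} ^ l * ν {x | (0 : ℝ) ≤ x i} ^ (1 - l)) := by
          rw [ENNReal.mul_rpow_of_nonneg _ _ hl0.le, ENNReal.mul_rpow_of_nonneg _ _ hl]; ring
      _ = 2 * (ν {x | a + b ≤ x i} ^ l * ν {x | (0 : ℝ) ≤ x i} ^ (1 - l)) := by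
          rw [← ENNReal.rpow_add _ _ (by simp) (by simp)]; simp
      _ ≤ _ := by gcongr
  have ma := main a b ha hb
  have mb := main b a hb ha
  rw [add_comm b a] at mb
  calc ν {x | a + b ≤ |x i|} = ν {x | a + b ≤ |x i|} ^ (a / (a + b)) *
        ν {x | a + b ≤ |x i|} ^ (b / (a + b)) := by
        rw [← ENNReal.rpow_add_of_nonneg _ _ (by positivity) (by positivity), ← add_div,
          div_self (by positivity), ENNReal.rpow_one]
    _ ≤ _ := mul_le_mul' ma mb

/-- Tail integral bound. -/
lemma tail_int {Ω : Type*} [MeasurableSpace Ω] (μ : Measure Ω) [IsProbabilityMeasure μ]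
    (Y : Ω → ℝ) (hY : Measurable Y) (hi : Integrable Y μ)
    (hmul : ∀ a b : ℝ, 0 < a → 0 < b →
      μ {ω | a + b ≤ |Y ω|} ≤ μ {ω | a ≤ |Y ω|} * μ {ω | b ≤ |Y ω|}) (s : ℝ) (hs : 0 < s) :
    ∫ ω in {ω | s ≤ |Y ω|}, |Y ω| ∂μ ≤ (s + ∫ ω, |Y ω| ∂μ) * (μ {ω | s ≤ |Y ω|}).toReal := by
  have hms : MeasurableSet {ω | s ≤ |Y ω|} := measurableSet_le measurable_const hY.abs
  set Z : Ω → ℝ := fun ω => max (|Y ω| - s) 0 with hZ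
  have hZi : Integrable Z μ := (hi.abs.sub (integrable_const s)).pos_part
  have hZ0 : 0 ≤ᵐ[μ] Z := Filter.Eventually.of_forall fun ω => le_max_right _ _
  have hY0 : 0 ≤ᵐ[μ] fun ω => |Y ω| := Filter.Eventually.of_forall fun ω => abs_nonneg _
  have e1 : ∫ ω in {ω | s ≤ |Y ω|}, |Y ω| ∂μ
      = ∫ ω in {ω | s ≤ |Y ω|}, (Z ω + s) ∂μ := by
    refine setIntegral_congr_fun hms fun ω hω => ?_
    simp only [Set.mem_ofPred_eq] at hω
    simp only [hZ]
    rw [max_eq_left (by linarith)]; ring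
  have e2 : ∫ ω in {ω | s ≤ |Y ω|}, (Z ω + s) ∂μ
      = ∫ ω in {ω | s ≤ |Y ω|}, Z ω ∂μ + s * (μ {ω | s ≤ |Y ω|}).toReal := by
    rw [integral_add hZi.integrableOn (integrable_const s).integrableOn]
    simp [Measure.real, mul_comm]
  have e3 : ∫ ω in {ω | s ≤ |Y ω|}, Z ω ∂μ ≤ ∫ ω, Z ω ∂μ :=
    setIntegral_le_integral hZi (Filter.Eventually.of_forall fun ω => le_max_right _ _)
  have e4 : ∫ ω, Z ω ∂μ ≤ (∫ ω, |Y ω| ∂μ) * (μ {ω | s ≤ |Y ω|}).toReal := by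
    rw [integral_eq_lintegral_of_nonneg_ae
        hZ0 hZi.aestronglyMeasurable,
      integral_eq_lintegral_of_nonneg_ae
        hY0 hi.abs.aestronglyMeasurable,
      ← ENNReal.toReal_mul]
    refine ENNReal.toReal_mono (ENNReal.mul_ne_top ?_ (measure_ne_top _ _)) ?_
    · exact (hasFiniteIntegral_iff_ofReal
        hY0).1 hi.abs.2 |>.ne
    rw [lintegral_eq_lintegral_meas_le μ hZ0
        hZi.aemeasurable,
      lintegral_eq_lintegral_meas_le μ hY0
        hi.abs.aemeasurable,
      ← lintegral_mul_const' _ _ (measure_ne_top _ _)]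
    refine setLIntegral_mono' measurableSet_Ioi fun u hu => ?_
    have hu : 0 < u := hu
    refine le_trans (measure_mono ?_) (hmul u s hu hs)
    intro ω hω
    simp only [Set.mem_ofPred_eq, hZ, le_max_iff] at hω ⊢
    rcases hω with h | h <;> linarith
  rw [e1, e2]; linarith

lemma top_set {n : ℕ} (k : ℕ) (hk1 : 1 ≤ k) (hkn : k ≤ n) (x : Fin n → ℝ) (hx : ∀ i, 0 ≤ x i) :
    (∃ I : Finset (Fin n), I.card = k ∧ maxKSum k x = ∑ i ∈ I, x i ∧
      ∀ i, i ∉ I → k * x i ≤ ∑ i ∈ I, x i) := by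
  obtain ⟨I, hI, hmax⟩ := Finset.exists_max_image (Finset.powersetCard k (Finset.univ : Finset (Fin n)))
    (fun I => ∑ i ∈ I, x i) (Finset.powersetCard_nonempty.2 (by simpa using hkn))
  have hc : I.card = k := (Finset.mem_powersetCard.1 hI).2
  have habs : ∀ J : Finset (Fin n), ∑ i ∈ J, |x i| = ∑ i ∈ J, x i := fun J =>
    Finset.sum_congr rfl fun i _ => abs_of_nonneg (hx i)
  refine ⟨I, hc, ?_, ?_⟩
  · refine IsGreatest.csSup_eq ⟨⟨I, hc, (habs I).symm⟩, ?_⟩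
    rintro y ⟨J, hJ, rfl⟩
    rw [habs]
    exact hmax J (by simp [Finset.mem_powersetCard, hJ])
  · intro i hi
    have : ∀ j ∈ I, x i ≤ x j := by
      intro j hj
      have hni : i ∉ I.erase j := fun h => hi (Finset.mem_of_mem_erase h)
      have h := hmax (insert i (I.erase j)) (by
        simp only [Finset.mem_powersetCard, Finset.subset_univ, true_and]
        rw [Finset.card_insert_of_notMem hni, Finset.card_erase_of_mem hj]; omega)
      rw [Finset.sum_insert hni] at h
      have := Finset.add_sum_erase I x hj
      linarith
    have h := Finset.card_nsmul_le_sum I x (x i) this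
    rw [hc, nsmul_eq_mul] at h
    exact h

theorem stmt_15 {Ω : Type*} [MeasurableSpace Ω] (μ : Measure Ω) [IsProbabilityMeasure μ]
    {n : ℕ} (X : Fin n → Ω → ℝ)
    (hmeas : ∀ i, Measurable (X i)) (hint : ∀ i, Integrable (X i) μ)
    (hsym : μ.map (fun ω i => X i ω) = μ.map (fun ω i => -X i ω))
    (hlc : IsLogConcave (μ.map (fun ω i => X i ω)))
    (k : ℕ) (hk1 : 1 ≤ k) (hkn : k ≤ n) :
    (1 / 3) * (tstar μ X k + (1 / (k : ℝ)) * maxKSum k (fun i => ∫ ω, |X i ω| ∂μ)) ≤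
        tk μ X k ∧
      tk μ X k ≤
        4 * (tstar μ X k + (1 / (k : ℝ)) * maxKSum k (fun i => ∫ ω, |X i ω| ∂μ)) := by
  classical
  have hk0 : (0 : ℝ) < k := by exact_mod_cast hk1
  have hXm : Measurable (fun ω i => X i ω) := measurable_pi_lambda _ hmeas
  set ν := μ.map (fun ω i => X i ω) with hν
  have : IsProbabilityMeasure ν := Measure.isProbabilityMeasure_map hXm.aemeasurable
  have hs : ν.map (fun x => -x) = ν := by
    conv_rhs => rw [hsym]
    rw [hν, Measure.map_map measurable_neg hXm]
    rfl
  have hν_ap : ∀ i (t : ℝ), ν {x | t ≤ |x i|} = μ {ω | t ≤ |X i ω|} := by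
    intro i t
    rw [hν, Measure.map_apply hXm
      (measurableSet_le measurable_const (measurable_pi_apply i).abs)]
    rfl
  have hmul : ∀ i (a b : ℝ), 0 < a → 0 < b →
      μ {ω | a + b ≤ |X i ω|} ≤ μ {ω | a ≤ |X i ω|} * μ {ω | b ≤ |X i ω|} := by
    intro i a b ha hb
    have := tail_mul ν hlc hs i a b ha hb
    simpa only [hν_ap] using this
  have hmulR : ∀ i (a b : ℝ), 0 < a → 0 < b →
      (μ {ω | a + b ≤ |X i ω|}).toReal
        ≤ (μ {ω | a ≤ |X i ω|}).toReal * (μ {ω | b ≤ |X i ω|}).toReal := by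
    intro i a b ha hb
    rw [← ENNReal.toReal_mul]
    exact ENNReal.toReal_mono (ENNReal.mul_ne_top (measure_ne_top _ _) (measure_ne_top _ _))
      (hmul i a b ha hb)
  set x : Fin n → ℝ := fun i => ∫ ω, |X i ω| ∂μ with hx
  have hx0 : ∀ i, 0 ≤ x i := fun i => integral_nonneg fun ω => abs_nonneg _
  obtain ⟨I, hIc, hImax, hIout⟩ := top_set k hk1 hkn x hx0
  set M : ℝ := (1 / (k : ℝ)) * maxKSum k x with hM
  have hkM : k * M = ∑ i ∈ I, x i := by
    rw [hM, hImax]; field_simp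
  have hM0 : 0 ≤ M := by
    rw [hM, hImax]
    exact mul_nonneg (by positivity) (Finset.sum_nonneg fun i _ => hx0 i)
  have hout : ∀ i, i ∉ I → x i ≤ M := by
    intro i hi
    have := hIout i hi
    rw [← hkM] at this
    exact le_of_mul_le_mul_left this hk0
  have hms : ∀ i (t : ℝ), MeasurableSet {ω | t ≤ |X i ω|} := fun i t =>
    measurableSet_le measurable_const (hmeas i).abs
  set f : Fin n → ℝ → ℝ := fun i t => ∫ ω in {ω | t ≤ |X i ω|}, |X i ω| ∂μ with hf
  have hf0 : ∀ i t, 0 ≤ f i t := fun i t => integral_nonneg fun ω => abs_nonneg _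
  have hfx : ∀ i t, f i t ≤ x i := fun i t =>
    setIntegral_le_integral (hint i).abs (Filter.Eventually.of_forall fun ω => abs_nonneg _)
  have hmarkov : ∀ i (t : ℝ), t * (μ {ω | t ≤ |X i ω|}).toReal ≤ f i t := by
    intro i t
    have h := setIntegral_mono_on (μ := μ) (s := {ω | t ≤ |X i ω|}) (f := fun _ => t)
      (g := fun ω => |X i ω|) (integrable_const t).integrableOn (hint i).abs.integrableOn
      (hms i t) (fun ω hω => hω)
    simpa [Measure.real, mul_comm] using h
  have hsplit : ∀ i (t : ℝ), 0 ≤ t → x i ≤ t + f i t := by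
    intro i t ht
    have h1 := integral_add_compl (hms i t) (hint i).abs
    have h2 : ∫ ω in {ω | t ≤ |X i ω|}ᶜ, |X i ω| ∂μ ≤ ∫ ω, t ∂μ := by
      refine le_trans (setIntegral_mono_on (g := fun _ => t) (hint i).abs.integrableOn
        (integrable_const t).integrableOn (hms i t).compl ?_) ?_
      · intro ω hω
        simp only [Set.mem_compl_iff, Set.mem_ofPred_eq, not_le] at hω
        exact hω.le
      · exact setIntegral_le_integral (integrable_const t) (Filter.Eventually.of_forall fun ω => ht)
    simp only [integral_const, probReal_univ, one_smul] at h2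
    simp only [hx, hf]
    linarith
  set A : Set ℝ := {t : ℝ | 0 < t ∧ ∑ i, f i t ≤ k * t} with hA
  set B : Set ℝ := {t : ℝ | 0 < t ∧ ∑ i, (μ {ω | t ≤ |X i ω|}).toReal ≤ k} with hB
  have htk : tk μ X k = sInf A := rfl
  have hts : tstar μ X k = sInf B := rfl
  have hAB : A ⊆ B := by
    rintro t ⟨ht, h⟩
    refine ⟨ht, ?_⟩
    have : t * ∑ i, (μ {ω | t ≤ |X i ω|}).toReal ≤ t * k := by
      rw [Finset.mul_sum, mul_comm t (k : ℝ)]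
      exact (Finset.sum_le_sum fun i _ => hmarkov i t).trans h
    exact le_of_mul_le_mul_left this ht
  have hS0 : 0 ≤ ∑ i, x i := Finset.sum_nonneg fun i _ => hx0 i
  have hAne : A.Nonempty := by
    refine ⟨(∑ i, x i) / k + 1, by positivity, ?_⟩
    refine (Finset.sum_le_sum fun i _ => hfx i _).trans ?_
    rw [mul_add, mul_div_cancel₀ _ hk0.ne']
    linarith
  have hAbd : BddBelow A := ⟨0, fun t ht => ht.1.le⟩
  have hBbd : BddBelow B := ⟨0, fun t ht => ht.1.le⟩
  rw [htk, hts]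
  constructor
  · refine le_csInf hAne fun t ht => ?_
    have h1 : sInf B ≤ t := csInf_le hBbd (hAB ht)
    have h2 : M ≤ 2 * t := by
      have : k * M ≤ k * (2 * t) := by
        rw [hkM]
        calc ∑ i ∈ I, x i ≤ ∑ i ∈ I, (t + f i t) :=
              Finset.sum_le_sum fun i _ => hsplit i t ht.1.le
          _ = k * t + ∑ i ∈ I, f i t := by
              rw [Finset.sum_add_distrib, Finset.sum_const, hIc, nsmul_eq_mul]
          _ ≤ k * t + ∑ i, f i t := by
              gcongr
              exact Finset.subset_univ I
          _ ≤ k * t + k * t := by linarith [ht.2]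
          _ = k * (2 * t) := by ring
      exact le_of_mul_le_mul_left this hk0
    linarith
  · have : sInf A / 4 - M ≤ sInf B := by
      refine le_csInf (hAne.mono hAB) fun t ht => ?_
      obtain ⟨ht0, htB⟩ := ht
      have : 4 * (t + M) ∈ A := by
        set s := 4 * (t + M) with hsdef
        have hs0 : 0 < s := by positivity
        refine ⟨hs0, ?_⟩
        have hg : ∀ i, i ∉ I → f i s ≤ (s + M) / 4 * (μ {ω | t ≤ |X i ω|}).toReal := by
          intro i hi
          have h1 : f i s ≤ (s + x i) * (μ {ω | s ≤ |X i ω|}).toReal :=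
            tail_int μ (X i) (hmeas i) (hint i) (hmul i) s hs0
          have hu0 : 0 < 3 * t + 4 * M := by positivity
          have h2 := hmulR i t (3 * t + 4 * M) ht0 hu0
          have e : t + (3 * t + 4 * M) = s := by rw [hsdef]; ring
          rw [e] at h2
          have h3 := (hmarkov i (3 * t + 4 * M)).trans ((hfx i _).trans (hout i hi))
          have h4 : (μ {ω | 3 * t + 4 * M ≤ |X i ω|}).toReal ≤ 1 / 4 := by
            refine le_of_mul_le_mul_left (h3.trans ?_) hu0
            linarith
          have hp : 0 ≤ (μ {ω | t ≤ |X i ω|}).toReal := ENNReal.toReal_nonneg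
          have h5 : (μ {ω | s ≤ |X i ω|}).toReal ≤ (μ {ω | t ≤ |X i ω|}).toReal * (1 / 4) :=
            h2.trans (mul_le_mul_of_nonneg_left h4 hp)
          calc f i s ≤ (s + x i) * (μ {ω | s ≤ |X i ω|}).toReal := h1
            _ ≤ (s + M) * ((μ {ω | t ≤ |X i ω|}).toReal * (1 / 4)) :=
                mul_le_mul (by linarith [hout i hi]) h5 ENNReal.toReal_nonneg (by positivity)
            _ = _ := by ring
        have hI1 : ∑ i ∈ I, f i s ≤ k * M := by
          rw [hkM]; exact Finset.sum_le_sum fun i _ => hfx i s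
        have hI2 : ∑ i ∈ Iᶜ, f i s ≤ (s + M) / 4 * k := by
          calc ∑ i ∈ Iᶜ, f i s ≤ ∑ i ∈ Iᶜ, (s + M) / 4 * (μ {ω | t ≤ |X i ω|}).toReal :=
                Finset.sum_le_sum fun i hi => hg i (Finset.mem_compl.1 hi)
            _ = (s + M) / 4 * ∑ i ∈ Iᶜ, (μ {ω | t ≤ |X i ω|}).toReal := by rw [Finset.mul_sum]
            _ ≤ (s + M) / 4 * ∑ i, (μ {ω | t ≤ |X i ω|}).toReal := by
                refine mul_le_mul_of_nonneg_left ?_ (by positivity)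
                exact Finset.sum_le_sum_of_subset_of_nonneg (Finset.subset_univ _)
                  fun i _ _ => ENNReal.toReal_nonneg
            _ ≤ _ := mul_le_mul_of_nonneg_left htB (by positivity)
        rw [← Finset.sum_add_sum_compl I]
        have h6 : M + (s + M) / 4 ≤ s := by rw [hsdef]; linarith
        have h7 := mul_le_mul_of_nonneg_left h6 hk0.le
        linarith
      have := csInf_le hAbd this
      linarith
    linarith
end
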